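/- arXiv:2009.02709 — 2 statements merged into one kernel-verified Lean document; each statement's English description precedes it below -/
import Mathlib

section
/- Feasibility of the rescaled gradient dual point: let f : ℝⁿ → ℝ ∪ {+∞} and Ω : ℝᵖ → ℝ ∪ {+∞} be proper convex functions that are bounded from below, let X ∈ ℝ^{n×p}, and let β ∈ ℝᵖ be such that f is differentiable at Xβ. Let C := dom Ω* and assume C is closed. Define the polar gauge σ°_C(v) := sup{⟨v, x⟩ : σ_C(x) ≤ 1}, assume σ°_C(−X^⊤ ∇f(Xβ)) < +∞, and set α := max(1, σ°_C(−X^⊤ ∇f(Xβ))) and θ := −∇f(Xβ)/α. Then −θ ∈ dom f* and X^⊤ θ ∈ dom Ω*. -/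
noncomputable section

/-- Fenchel conjugate of an extended-real-valued function:
`h*(v) = sup_x ⟨v, x⟩ − h(x)`. -/
def fconj {m : ℕ} (h : EuclideanSpace ℝ (Fin m) → EReal) (v : EuclideanSpace ℝ (Fin m)) : EReal :=
  ⨆ x, ((inner ℝ v x : ℝ) : EReal) - h x

/-- Support function of a set: `σ_C(d) = sup_{c ∈ C} ⟨c, d⟩`. -/
def sfun {m : ℕ} (C : Set (EuclideanSpace ℝ (Fin m))) (d : EuclideanSpace ℝ (Fin m)) : EReal :=
  ⨆ c ∈ C, ((inner ℝ c d : ℝ) : EReal)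

/-- Polar gauge of a set `C`: `σ°_C(v) = sup{⟨v, x⟩ : σ_C(x) ≤ 1}`. -/
def polarGauge {m : ℕ} (C : Set (EuclideanSpace ℝ (Fin m))) (v : EuclideanSpace ℝ (Fin m)) :
    EReal :=
  ⨆ x ∈ {x | sfun C x ≤ (1 : EReal)}, ((inner ℝ v x : ℝ) : EReal)

/-- Convexity for an extended-real-valued function. -/
def ERealConvexOn {m : ℕ} (h : EuclideanSpace ℝ (Fin m) → EReal) : Prop :=
  ∀ x y : EuclideanSpace ℝ (Fin m), ∀ a b : ℝ, 0 ≤ a → 0 ≤ b → a + b = 1 →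
    h (a • x + b • y) ≤ (a : EReal) * h x + (b : EReal) * h y

/-- `X v` for a matrix `X ∈ ℝ^{n×p}` and `v ∈ ℝᵖ`. -/
def mv {n p : ℕ} (X : Matrix (Fin n) (Fin p) ℝ) (v : EuclideanSpace ℝ (Fin p)) :
    EuclideanSpace ℝ (Fin n) :=
  WithLp.toLp 2 (fun i => ∑ j, X i j * v j)

/-- `X^⊤ θ` for a matrix `X ∈ ℝ^{n×p}` and `θ ∈ ℝⁿ`. -/
def mvT {n p : ℕ} (X : Matrix (Fin n) (Fin p) ℝ) (θ : EuclideanSpace ℝ (Fin n)) :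
    EuclideanSpace ℝ (Fin p) :=
  WithLp.toLp 2 (fun j => ∑ i, X i j * θ i)

theorem fconj_ne_top_iff {m : ℕ} (h : EuclideanSpace ℝ (Fin m) → EReal) (hb : ∀ x, h x ≠ ⊥)
    (v : EuclideanSpace ℝ (Fin m)) :
    fconj h v ≠ ⊤ ↔ ∃ K : ℝ, ∀ x, ((inner ℝ v x - K : ℝ) : EReal) ≤ h x := by
  have key : ∀ (K : ℝ) (x : EuclideanSpace ℝ (Fin m)),
      (((inner ℝ v x : ℝ) : EReal) - h x ≤ K ↔ ((inner ℝ v x - K : ℝ) : EReal) ≤ h x) := by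
    intro K x
    have := hb x
    induction hx : h x with
    | bot => exact absurd hx this
    | top => simp
    | coe r =>
      rw [← EReal.coe_sub, EReal.coe_le_coe_iff, EReal.coe_le_coe_iff]
      constructor <;> intro _ <;> linarith
  constructor
  · intro ht
    obtain ⟨K, hK⟩ : ∃ K : ℝ, fconj h v ≤ K := by
      induction hx : fconj h v with
      | bot => exact ⟨0, bot_le⟩
      | top => exact absurd hx ht
      | coe r => exact ⟨r, le_rfl⟩
    exact ⟨K, fun x => (key K x).1 ((le_iSup (fun x => ((inner ℝ v x : ℝ) : EReal) - h x) x).trans hK)⟩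
  · rintro ⟨K, hK⟩
    have : fconj h v ≤ K := iSup_le fun x => (key K x).2 (hK x)
    exact ne_top_of_le_ne_top (EReal.coe_ne_top K) this

theorem dom_fconj_convex {m : ℕ} (h : EuclideanSpace ℝ (Fin m) → EReal) (hb : ∀ x, h x ≠ ⊥) :
    Convex ℝ {v | fconj h v ≠ ⊤} := by
  intro v hv w hw a b ha hb' hab
  rw [Set.mem_ofPred_eq, fconj_ne_top_iff h hb] at *
  obtain ⟨K, hK⟩ := hv
  obtain ⟨L, hL⟩ := hw
  refine ⟨a * K + b * L, fun x => ?_⟩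
  have h1 := hK x
  have h2 := hL x
  have := hb x
  induction hx : h x with
  | bot => exact absurd hx this
  | top => simp
  | coe r =>
    rw [hx, EReal.coe_le_coe_iff] at h1 h2
    rw [EReal.coe_le_coe_iff, inner_add_left, real_inner_smul_left, real_inner_smul_left]
    have hr : r = a * r + b * r := by rw [← add_mul, hab, one_mul]
    nlinarith [mul_le_mul_of_nonneg_left h1 ha, mul_le_mul_of_nonneg_left h2 hb']

theorem zero_mem_dom {m : ℕ} (h : EuclideanSpace ℝ (Fin m) → EReal) (hb : ∀ x, h x ≠ ⊥)
    (hc : ∃ c : ℝ, ∀ x, (c : EReal) ≤ h x) : fconj h 0 ≠ ⊤ := by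
  rw [fconj_ne_top_iff h hb]
  obtain ⟨c, hc⟩ := hc
  exact ⟨-c, fun x => by simpa using hc x⟩

theorem grad_mem_dom {m : ℕ} (f : EuclideanSpace ℝ (Fin m) → EReal) (hb : ∀ x, f x ≠ ⊥)
    (hconv : ERealConvexOn f) (x₀ g : EuclideanSpace ℝ (Fin m)) (hx₀ : f x₀ ≠ ⊤)
    (hg : HasGradientAt (fun x => (f x).toReal) g x₀) : fconj f g ≠ ⊤ := by
  rw [fconj_ne_top_iff f hb]
  refine ⟨inner ℝ g x₀ - (f x₀).toReal, fun y => ?_⟩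
  by_cases hy : f y = ⊤
  · simp [hy]
  rw [← EReal.coe_toReal hy (hb y), EReal.coe_le_coe_iff]
  have hline : HasDerivAt (fun t : ℝ => x₀ + t • (y - x₀)) (y - x₀) 0 := by
    simpa using ((hasDerivAt_id (0 : ℝ)).smul_const (y - x₀)).const_add x₀
  have hd : HasDerivAt (fun t : ℝ => (f (x₀ + t • (y - x₀))).toReal) (inner ℝ g (y - x₀)) 0 := by
    have h1 : HasFDerivAt (fun x => (f x).toReal)
        (InnerProductSpace.toDual ℝ (EuclideanSpace ℝ (Fin m)) g) (x₀ + (0 : ℝ) • (y - x₀)) := by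
      simpa using hg.hasFDerivAt
    have h2 := h1.comp_hasDerivAt (0 : ℝ) hline
    rw [InnerProductSpace.toDual_apply_apply] at h2
    exact h2
  have hs := hasDerivWithinAt_iff_tendsto_slope.1 (hd.hasDerivWithinAt (s := Set.Ioi 0))
  have hle : inner ℝ g (y - x₀) ≤ (f y).toReal - (f x₀).toReal := by
    have hset : Set.Ioi (0 : ℝ) \ {0} = Set.Ioi 0 := by simp
    rw [hset] at hs
    refine le_of_tendsto hs ?_
    filter_upwards [Ioo_mem_nhdsGT (zero_lt_one (α := ℝ))] with t ht
    have hc := hconv x₀ y (1 - t) t (by linarith [ht.2]) ht.1.le (by ring)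
    have e : (1 - t) • x₀ + t • y = x₀ + t • (y - x₀) := by module
    rw [e, ← EReal.coe_toReal hy (hb y), ← EReal.coe_toReal hx₀ (hb x₀), ← EReal.coe_mul,
      ← EReal.coe_mul, ← EReal.coe_add] at hc
    have hc' := EReal.toReal_le_toReal hc (hb _) (EReal.coe_ne_top _)
    rw [EReal.toReal_coe] at hc'
    rw [slope_def_field, div_le_iff₀ (by linarith [ht.1])]
    simp only [zero_smul, add_zero, sub_zero]
    linarith
  rw [inner_sub_right] at hle
  linarith

theorem mvT_smul {n p : ℕ} (X : Matrix (Fin n) (Fin p) ℝ) (a : ℝ) (g : EuclideanSpace ℝ (Fin n)) :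
    mvT X (-a • g) = a • (-(mvT X g)) := by
  ext j
  simp only [mvT, PiLp.smul_apply, PiLp.neg_apply, smul_eq_mul, Finset.mul_sum,
    ← Finset.sum_neg_distrib]
  exact Finset.sum_congr rfl fun i _ => by ring

theorem mem_of_polarGauge {m : ℕ} (C : Set (EuclideanSpace ℝ (Fin m))) (hC : IsClosed C)
    (hconv : Convex ℝ C) (h0 : (0 : EuclideanSpace ℝ (Fin m)) ∈ C)
    (v : EuclideanSpace ℝ (Fin m)) (α : ℝ) (hα : 0 < α) (hv : polarGauge C v ≤ α) :
    (1 / α) • v ∈ C := by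
  by_contra hw
  obtain ⟨l, s, hl, hs⟩ := geometric_hahn_banach_closed_point hconv hC hw
  obtain ⟨u, rfl⟩ := (InnerProductSpace.toDual ℝ (EuclideanSpace ℝ (Fin m))).surjective l
  simp only [InnerProductSpace.toDual_apply_apply] at hl hs
  have hs0 : 0 < s := by simpa using hl 0 h0
  have h1 : sfun C (s⁻¹ • u) ≤ 1 := by
    refine iSup₂_le fun c hc => ?_
    rw [← EReal.coe_one, EReal.coe_le_coe_iff, real_inner_smul_right, real_inner_comm,
      inv_mul_le_iff₀ hs0]
    linarith [hl c hc]
  have h2 : ((inner ℝ v (s⁻¹ • u) : ℝ) : EReal) ≤ α :=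
    le_trans (le_iSup₂ (f := fun x (_ : x ∈ {x | sfun C x ≤ (1 : EReal)}) =>
      ((inner ℝ v x : ℝ) : EReal)) (s⁻¹ • u) h1) hv
  rw [EReal.coe_le_coe_iff, real_inner_smul_right, real_inner_comm, inv_mul_le_iff₀ hs0] at h2
  rw [real_inner_smul_right, one_div, lt_inv_mul_iff₀ hα] at hs
  linarith

/-- **Feasibility of the rescaled gradient dual point.** For `f`, `Ω` proper convex
and bounded below, `f` differentiable at `Xβ`, `C = dom Ω*` closed, and
`α = max(1, σ°_C(−X^⊤∇f(Xβ)))` finite, the vector `θ = −∇f(Xβ)/α` satisfies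
`−θ ∈ dom f*` and `X^⊤θ ∈ dom Ω*`. -/
theorem feasibility_rescaled_gradient_dual_point (n p : ℕ)
    (f : EuclideanSpace ℝ (Fin n) → EReal) (Ω : EuclideanSpace ℝ (Fin p) → EReal)
    (hf_ne_bot : ∀ x, f x ≠ ⊥) (hf_proper : ∃ x, f x ≠ ⊤) (hf_convex : ERealConvexOn f)
    (hΩ_ne_bot : ∀ x, Ω x ≠ ⊥) (hΩ_proper : ∃ x, Ω x ≠ ⊤) (hΩ_convex : ERealConvexOn Ω)
    (hf_bddBelow : ∃ c : ℝ, ∀ x, (c : EReal) ≤ f x)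
    (hΩ_bddBelow : ∃ c : ℝ, ∀ x, (c : EReal) ≤ Ω x)
    (X : Matrix (Fin n) (Fin p) ℝ) (β : EuclideanSpace ℝ (Fin p))
    (gradf : EuclideanSpace ℝ (Fin n))
    (hf_finite_near : ∀ᶠ x in nhds (mv X β), f x ≠ ⊤)
    (hgrad : HasGradientAt (fun x => (f x).toReal) gradf (mv X β))
    (hC_closed : IsClosed {v : EuclideanSpace ℝ (Fin p) | fconj Ω v ≠ ⊤})
    (hpolar_finite : polarGauge {v | fconj Ω v ≠ ⊤} (-(mvT X gradf)) ≠ ⊤) :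
    letI α : ℝ := max 1 (polarGauge {v | fconj Ω v ≠ ⊤} (-(mvT X gradf))).toReal
    letI θ : EuclideanSpace ℝ (Fin n) := (-(1 / α)) • gradf
    fconj f (-θ) ≠ ⊤ ∧ fconj Ω (mvT X θ) ≠ ⊤ := by
  have hx₀ : f (mv X β) ≠ ⊤ := hf_finite_near.self_of_nhds
  set α : ℝ := max 1 (polarGauge {v | fconj Ω v ≠ ⊤} (-(mvT X gradf))).toReal
  set θ : EuclideanSpace ℝ (Fin n) := (-(1 / α)) • gradf
  have hα : 1 ≤ α := le_max_left _ _
  have hα0 : 0 < α := by linarith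
  have hle : 1 / α ≤ 1 := by rw [div_le_one hα0]; exact hα
  constructor
  · have e : -θ = (1 / α) • gradf := by simp [θ]
    rw [e]
    have := (dom_fconj_convex f hf_ne_bot).smul_mem_of_zero_mem
      (zero_mem_dom f hf_ne_bot hf_bddBelow)
      (grad_mem_dom f hf_ne_bot hf_convex _ _ hx₀ hgrad) ⟨by positivity, hle⟩
    exact this
  · have e : mvT X θ = (1 / α) • (-(mvT X gradf)) := mvT_smul X _ _
    rw [e]
    exact mem_of_polarGauge _ hC_closed (dom_fconj_convex Ω hΩ_ne_bot)
      (zero_mem_dom Ω hΩ_ne_bot hΩ_bddBelow) _ α hα0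
      ((EReal.le_coe_toReal hpolar_finite).trans
        (EReal.coe_le_coe_iff.2 (le_max_right _ _)))
end
end

section
/- Duality gap bound for bounded-support regularizers: let f : ℝⁿ → ℝ be convex, differentiable and ν_f-smooth, let Ω : ℝᵖ → ℝ ∪ {+∞} be proper, closed and convex with dom Ω contained in the closed ball of radius L > 0 centered at 0, let X ∈ ℝ^{n×p} with operator norm ‖X‖_{op}, and let β̂ minimize P(β) = f(Xβ) + Ω(β). For β ∈ dom Ω set θ := −∇f(Xβ), assume −θ ∈ dom f* and let u ∈ ∂Ω*(X^⊤ θ) (nonempty since Ω* is finite everywhere). Write E := P(β) − P(β̂). If E ≤ 2 ν_f ‖X‖²_{op} L², then Gap(β, θ) ≤ √( 8 ν_f ‖X‖²_{op} L² · E ). -/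
noncomputable section

/-- Fenchel conjugate of a real-valued function. -/
def fconjR {m : ℕ} (h : EuclideanSpace ℝ (Fin m) → ℝ) (v : EuclideanSpace ℝ (Fin m)) : EReal :=
  ⨆ x, (((inner ℝ v x : ℝ) - h x : ℝ) : EReal)

/-- Subdifferential of an extended-real-valued function. -/
def subdiff {m : ℕ} (h : EuclideanSpace ℝ (Fin m) → EReal)
    (x : EuclideanSpace ℝ (Fin m)) : Set (EuclideanSpace ℝ (Fin m)) :=
  {v | ∀ z, h x + ((inner ℝ v (z - x) : ℝ) : EReal) ≤ h z}

/-- Operator (spectral) norm of a matrix acting between Euclidean spaces. -/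
def opNorm {n p : ℕ} (X : Matrix (Fin n) (Fin p) ℝ) : ℝ :=
  ‖LinearMap.toContinuousLinearMap (Matrix.toEuclideanLin X)‖

theorem aux_line {n : ℕ} (f : EuclideanSpace ℝ (Fin n) → ℝ)
    (gradf : EuclideanSpace ℝ (Fin n) → EuclideanSpace ℝ (Fin n))
    (hgrad : ∀ x, HasGradientAt f (gradf x) x) (x d : EuclideanSpace ℝ (Fin n)) (t : ℝ) :
    HasDerivAt (fun t : ℝ => f (x + t • d)) (inner ℝ (gradf (x + t • d)) d) t := by
  have h1 : HasDerivAt (fun t : ℝ => x + t • d) d t := by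
    simpa using ((hasDerivAt_id t).smul_const d).const_add x
  have h2 := (hgrad (x + t • d)).hasFDerivAt.comp_hasDerivAt t h1
  simpa [Function.comp_def] using h2

theorem aux_convex {n : ℕ} (f : EuclideanSpace ℝ (Fin n) → ℝ)
    (hf : ConvexOn ℝ Set.univ f)
    (gradf : EuclideanSpace ℝ (Fin n) → EuclideanSpace ℝ (Fin n))
    (hgrad : ∀ x, HasGradientAt f (gradf x) x) (x y : EuclideanSpace ℝ (Fin n)) :
    f x + inner ℝ (gradf x) (y - x) ≤ f y := by
  have hd := aux_line f gradf hgrad x (y - x) 0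
  have hc : ConvexOn ℝ Set.univ (fun t : ℝ => f (x + t • (y - x))) := by
    refine ⟨convex_univ, ?_⟩
    intro s _ t _ a b ha hb hab
    have := hf.2 (Set.mem_univ (x + s • (y - x))) (Set.mem_univ (x + t • (y - x))) ha hb hab
    refine le_trans (le_of_eq ?_) this
    show f _ = f _
    congr 1
    have : x = (a + b) • x := by rw [hab, one_smul]
    nth_rewrite 1 [this]
    simp only [smul_eq_mul]
    module
  have := hc.le_slope_of_hasDerivAt (Set.mem_univ 0) (Set.mem_univ 1) one_pos hd
  simp [slope] at this
  linarith

theorem aux_descent {n : ℕ} (f : EuclideanSpace ℝ (Fin n) → ℝ)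
    (gradf : EuclideanSpace ℝ (Fin n) → EuclideanSpace ℝ (Fin n))
    (hgrad : ∀ x, HasGradientAt f (gradf x) x) (ν : ℝ)
    (hs : ∀ x y, ‖gradf x - gradf y‖ ≤ ν * ‖x - y‖) (x d : EuclideanSpace ℝ (Fin n)) :
    f (x + d) ≤ f x + inner ℝ (gradf x) d + ν / 2 * ‖d‖ ^ 2 := by
  have hd : ∀ t : ℝ, HasDerivAt
      (fun t : ℝ => f (x + t • d) - t * inner ℝ (gradf x) d - ν / 2 * ‖d‖ ^ 2 * t ^ 2)
      (inner ℝ (gradf (x + t • d)) d - inner ℝ (gradf x) d - ν * ‖d‖ ^ 2 * t) t := by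
    intro t
    have h := ((aux_line f gradf hgrad x d t).sub
      ((hasDerivAt_id t).mul_const (inner ℝ (gradf x) d))).sub
      ((hasDerivAt_pow 2 t).const_mul (ν / 2 * ‖d‖ ^ 2))
    refine h.congr_deriv ?_
    simp
    ring
  have hanti := antitoneOn_of_deriv_nonpos (convex_Icc (0 : ℝ) 1)
    (fun t _ => (hd t).continuousAt.continuousWithinAt)
    (fun t _ => (hd t).differentiableAt.differentiableWithinAt)
    (by
      intro t ht
      rw [interior_Icc] at ht
      rw [(hd t).deriv]
      have h1 : inner ℝ (gradf (x + t • d) - gradf x) d ≤ ‖gradf (x + t • d) - gradf x‖ * ‖d‖ :=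
        real_inner_le_norm _ _
      have h2 := hs (x + t • d) x
      rw [add_sub_cancel_left, norm_smul, Real.norm_of_nonneg ht.1.le] at h2
      rw [inner_sub_left] at h1
      nlinarith [mul_le_mul_of_nonneg_right h2 (norm_nonneg d)])
  have := hanti (Set.left_mem_Icc.2 zero_le_one) (Set.right_mem_Icc.2 zero_le_one) zero_le_one
  simp at this
  linarith

theorem aux_scalar (K E G : ℝ) (hK : 0 ≤ K) (hE : 0 ≤ E) (hEK : E ≤ 2 * K)
    (h : ∀ s : ℝ, 0 < s → s ≤ 1 → s * G ≤ E + 2 * K * s ^ 2) : G ≤ Real.sqrt (8 * K * E) := by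
  rcases hE.eq_or_lt with rfl | hE'
  · simp only [mul_zero, Real.sqrt_zero]
    by_contra hG
    push Not at hG
    have hp : 0 < G + 2 * K := by linarith
    have hs : 0 < G / (2 * (G + 2 * K)) := by positivity
    have := h (G / (2 * (G + 2 * K))) hs (by rw [div_le_one (by positivity)]; linarith)
    set s := G / (2 * (G + 2 * K)) with hsd
    have h3 : s * (2 * (G + 2 * K)) = G := by rw [hsd]; field_simp
    nlinarith
  · have hK' : 0 < K := by linarith
    have hr : 0 < Real.sqrt (E / (2 * K)) := Real.sqrt_pos.2 (by positivity)
    have h2 := h _ hr (Real.sqrt_le_one.2 (by rw [div_le_one (by positivity)]; exact hEK))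
    have hsq : Real.sqrt (E / (2 * K)) ^ 2 = E / (2 * K) := Real.sq_sqrt (by positivity)
    set s := Real.sqrt (E / (2 * K))
    have hE2 : E = 2 * K * s ^ 2 := by rw [hsq]; field_simp
    rw [show 8 * K * E = (4 * K * s) ^ 2 by rw [hE2]; ring, Real.sqrt_sq (by positivity)]
    have h5 : s * G ≤ s * (4 * K * s) := by nlinarith
    exact le_of_mul_le_mul_left h5 hr

theorem aux_mv {n p : ℕ} (X : Matrix (Fin n) (Fin p) ℝ) (v : EuclideanSpace ℝ (Fin p)) :
    mv X v = Matrix.toEuclideanLin X v := by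
  ext i
  simp [mv, Matrix.toLpLin_apply, Matrix.mulVec, dotProduct]

theorem aux_norm {n p : ℕ} (X : Matrix (Fin n) (Fin p) ℝ) (v : EuclideanSpace ℝ (Fin p)) :
    ‖mv X v‖ ≤ opNorm X * ‖v‖ := by
  rw [aux_mv]
  exact (LinearMap.toContinuousLinearMap (Matrix.toEuclideanLin X)).le_opNorm v

theorem aux_mvT {n p : ℕ} (X : Matrix (Fin n) (Fin p) ℝ) (θ : EuclideanSpace ℝ (Fin n))
    (v : EuclideanSpace ℝ (Fin p)) :
    inner ℝ (mvT X θ) v = inner ℝ θ (mv X v) := by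
  simp only [mv, mvT, PiLp.inner_apply, RCLike.inner_apply, conj_trivial, Finset.mul_sum, Finset.sum_mul]
  rw [Finset.sum_comm]
  refine Finset.sum_congr rfl fun i _ => Finset.sum_congr rfl fun j _ => by ring

/-- **Duality gap bound for bounded-support regularizers.** If `dom Ω` is contained
in the ball of radius `L`, `θ = −∇f(Xβ)`, `−θ ∈ dom f*`, `u ∈ ∂Ω*(X^⊤θ)` and
`E = P(β) − P(β̂) ≤ 2ν_f‖X‖²_op L²`, then `Gap(β,θ) ≤ √(8ν_f‖X‖²_op L² E)`. -/
theorem duality_gap_bound_bounded_support (n p : ℕ)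
    (f : EuclideanSpace ℝ (Fin n) → ℝ) (hf_convex : ConvexOn ℝ Set.univ f)
    (gradf : EuclideanSpace ℝ (Fin n) → EuclideanSpace ℝ (Fin n))
    (hgrad : ∀ x, HasGradientAt f (gradf x) x)
    (νf : ℝ) (hν : 0 ≤ νf)
    (hsmooth : ∀ x y, ‖gradf x - gradf y‖ ≤ νf * ‖x - y‖)
    (Ω : EuclideanSpace ℝ (Fin p) → EReal)
    (hΩ_ne_bot : ∀ x, Ω x ≠ ⊥) (hΩ_proper : ∃ x, Ω x ≠ ⊤)
    (hΩ_closed : LowerSemicontinuous Ω) (hΩ_convex : ERealConvexOn Ω)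
    (L : ℝ) (hL : 0 < L)
    (hΩ_bdd_support : {x | Ω x ≠ ⊤} ⊆ Metric.closedBall 0 L)
    (X : Matrix (Fin n) (Fin p) ℝ)
    (βhat : EuclideanSpace ℝ (Fin p))
    (hmin : ∀ b, ((f (mv X βhat) : ℝ) : EReal) + Ω βhat ≤ ((f (mv X b) : ℝ) : EReal) + Ω b)
    (β : EuclideanSpace ℝ (Fin p)) (hβ_dom : Ω β ≠ ⊤)
    (θ : EuclideanSpace ℝ (Fin n)) (hθ : θ = -gradf (mv X β))
    (hθ_dom : fconjR f (-θ) ≠ ⊤)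
    (u : EuclideanSpace ℝ (Fin p)) (hu : u ∈ subdiff (fconj Ω) (mvT X θ)) :
    letI P : EuclideanSpace ℝ (Fin p) → EReal := fun b => ((f (mv X b) : ℝ) : EReal) + Ω b
    letI Esub : ℝ := (P β - P βhat).toReal
    Esub ≤ 2 * νf * (opNorm X) ^ 2 * L ^ 2 →
      P β - (-(fconjR f (-θ)) - fconj Ω (mvT X θ))
        ≤ ((Real.sqrt (8 * νf * (opNorm X) ^ 2 * L ^ 2 * Esub) : ℝ) : EReal) := by
  let P : EuclideanSpace ℝ (Fin p) → EReal := fun b => ((f (mv X b) : ℝ) : EReal) + Ω b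
  let Esub : ℝ := (P β - P βhat).toReal
  show Esub ≤ 2 * νf * (opNorm X) ^ 2 * L ^ 2 →
      P β - (-(fconjR f (-θ)) - fconj Ω (mvT X θ))
        ≤ ((Real.sqrt (8 * νf * (opNorm X) ^ 2 * L ^ 2 * Esub) : ℝ) : EReal)
  intro hE
  have hPb : ∀ b, P b = ((f (mv X b) : ℝ) : EReal) + Ω b := fun _ => rfl
  have hbh : Ω βhat ≠ ⊤ := by
    intro h
    have := hmin β
    rw [h, EReal.coe_add_top, top_le_iff] at this
    lift Ω β to ℝ using ⟨hβ_dom, hΩ_ne_bot β⟩ with ob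
    exact absurd this (EReal.coe_ne_top (f (mv X β) + ob))
  obtain ⟨ob, hob⟩ : ∃ r : ℝ, Ω β = r := ⟨_, (EReal.coe_toReal hβ_dom (hΩ_ne_bot β)).symm⟩
  obtain ⟨oh, hoh⟩ : ∃ r : ℝ, Ω βhat = r := ⟨_, (EReal.coe_toReal hbh (hΩ_ne_bot βhat)).symm⟩
  have hEs : Esub = (f (mv X β) + ob) - (f (mv X βhat) + oh) := by
    show (P β - P βhat).toReal = _
    rw [hPb, hPb, hob, hoh]
    norm_cast
  have hE0 : 0 ≤ Esub := by
    have := hmin β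
    rw [hob, hoh] at this
    norm_cast at this
    rw [hEs]; linarith
  set S := Real.sqrt (8 * νf * (opNorm X) ^ 2 * L ^ 2 * Esub) with hS
  set g := gradf (mv X β) with hg
  have hF : fconjR f (-θ) ≤ ((inner ℝ g (mv X β) - f (mv X β) : ℝ) : EReal) := by
    refine iSup_le fun x => ?_
    rw [hθ, neg_neg]
    have := aux_convex f hf_convex gradf hgrad (mv X β) x
    rw [inner_sub_right] at this
    exact EReal.coe_le_coe_iff.2 (by linarith)
  have hW : fconj Ω (mvT X θ) ≤ ((S - ob - inner ℝ g (mv X β) : ℝ) : EReal) := by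
    refine iSup_le fun z => ?_
    by_cases hz : Ω z = ⊤
    · rw [hz, EReal.sub_top]; exact bot_le
    obtain ⟨oz, hoz⟩ : ∃ r : ℝ, Ω z = r := ⟨_, (EReal.coe_toReal hz (hΩ_ne_bot z)).symm⟩
    rw [hoz, aux_mvT, hθ, inner_neg_left, ← EReal.coe_sub]
    refine EReal.coe_le_coe_iff.2 ?_
    have key : ob - oz + inner ℝ g (mv X β) - inner ℝ g (mv X z) ≤
        Real.sqrt (8 * (νf * (opNorm X) ^ 2 * L ^ 2) * Esub) := by
      refine aux_scalar _ _ _ (by positivity) hE0 (by linarith) ?_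
      intro s hs0 hs1
      have hcv := hΩ_convex β z (1 - s) s (by linarith) hs0.le (by ring)
      rw [hob, hoz] at hcv
      have hm := (hmin ((1 - s) • β + s • z)).trans (add_le_add_right hcv _)
      rw [hoh] at hm
      norm_cast at hm
      have hlin : mv X ((1 - s) • β + s • z) = mv X β + s • mv X (z - β) := by
        simp only [aux_mv, map_add, map_smul, map_sub]
        module
      rw [hlin] at hm
      have hde := aux_descent f gradf hgrad νf hsmooth (mv X β) (s • mv X (z - β))
      have hn : ‖mv X (z - β)‖ ≤ opNorm X * (2 * L) := by
        refine (aux_norm X _).trans (mul_le_mul_of_nonneg_left ?_ (norm_nonneg _))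
        have h1 := hΩ_bdd_support (show β ∈ {x | Ω x ≠ ⊤} from hβ_dom)
        have h2 := hΩ_bdd_support (show z ∈ {x | Ω x ≠ ⊤} from hz)
        rw [mem_closedBall_zero_iff] at h1 h2
        linarith [norm_sub_le z β]
      have hn2 : ‖mv X (z - β)‖ ^ 2 ≤ (opNorm X * (2 * L)) ^ 2 :=
        pow_le_pow_left₀ (norm_nonneg _) hn 2
      have hn3 := mul_le_mul_of_nonneg_left hn2 (show 0 ≤ νf / 2 * s ^ 2 by positivity)
      have hsub : mv X (z - β) = mv X z - mv X β := by simp only [aux_mv, map_sub]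
      rw [norm_smul, Real.norm_of_nonneg hs0.le, mul_pow, inner_smul_right, ← hg] at hde
      have hi : inner ℝ g (mv X (z - β)) = inner ℝ g (mv X z) - inner ℝ g (mv X β) := by
        rw [hsub, inner_sub_right]
      rw [hi] at hde
      rw [hEs]
      nlinarith
    have hSS : S = Real.sqrt (8 * (νf * (opNorm X) ^ 2 * L ^ 2) * Esub) := by
      rw [hS]; congr 1; ring
    rw [hSS]
    linarith
  have h1 := EReal.sub_le_sub (EReal.neg_le_neg_iff.2 hF) hW
  refine (EReal.sub_le_sub (le_refl (P β)) h1).trans ?_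
  rw [hPb, hob]
  norm_cast
  apply le_of_eq
  ring
end
end
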